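/- Let 2 < p < q be real numbers. Let f_p be a bounded Legendre solution of parameter p with largest zero z_p ∈ (−1,1), and let f_q be a bounded Legendre solution of parameter q with largest zero z_q ∈ (−1,1). Then z_p < z_q: the largest zero of the bounded Legendre solution is strictly increasing in the parameter p on (2, ∞). -/

import Mathlib

/-- A bounded Legendre solution of parameter `p`: twice continuously differentiable on
`(−1,1)`, solving the Legendre equation there, and tending to `1` at `1⁻`. -/
def IsBddLegendreSol (p : ℝ) (f : ℝ → ℝ) : Prop :=
  ContDiffOn ℝ 2 f (Set.Ioo (-1 : ℝ) 1) ∧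
  (∀ x ∈ Set.Ioo (-1 : ℝ) 1,
    (1 - x ^ 2) * deriv (deriv f) x - 2 * x * deriv f x + p * f x = 0) ∧
  Filter.Tendsto f (nhdsWithin 1 (Set.Iio 1)) (nhds 1)

/-- `z` is the largest zero of `f` in `(−1,1)`: `f(z) = 0` and `f > 0` on `(z,1)`. -/
def IsLargestZero (f : ℝ → ℝ) (z : ℝ) : Prop :=
  z ∈ Set.Ioo (-1 : ℝ) 1 ∧ f z = 0 ∧ ∀ x ∈ Set.Ioo z (1 : ℝ), 0 < f x

lemma legendre_derivs {f : ℝ → ℝ} (h : ContDiffOn ℝ 2 f (Set.Ioo (-1 : ℝ) 1)) {x : ℝ}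
    (hx : x ∈ Set.Ioo (-1 : ℝ) 1) :
    HasDerivAt f (deriv f x) x ∧ HasDerivAt (deriv f) (deriv (deriv f) x) x := by
  have hn : Set.Ioo (-1 : ℝ) 1 ∈ nhds x := isOpen_Ioo.mem_nhds hx
  have h1 : ContDiffOn ℝ 1 (deriv f) (Set.Ioo (-1 : ℝ) 1) :=
    h.deriv_of_isOpen isOpen_Ioo (by norm_num)
  exact ⟨((h.differentiableOn (by norm_num)).differentiableAt hn).hasDerivAt,
    ((h1.differentiableOn (by norm_num)).differentiableAt hn).hasDerivAt⟩

lemma legendre_deriv_nonneg {f : ℝ → ℝ} {z d : ℝ} (hz : z < 1) (h : HasDerivAt f d z)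
    (h0 : f z = 0) (hpos : ∀ x ∈ Set.Ioo z (1 : ℝ), 0 < f x) : 0 ≤ d := by
  have h1 := (hasDerivAt_iff_tendsto_slope.1 h).mono_left
    (nhdsWithin_mono z (fun x (hx : x ∈ Set.Ioi z) => (ne_of_gt hx : x ≠ z)))
  refine ge_of_tendsto h1 ?_
  filter_upwards [Ioo_mem_nhdsGT hz] with x hx
  rw [slope_def_field, h0, sub_zero]
  exact div_nonneg (hpos x hx).le (sub_nonneg.2 hx.1.le)

/-- The largest zero of the bounded Legendre solution is strictly increasing in the
parameter on `(2,∞)`. -/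
theorem largest_zero_strictMono (p q : ℝ) (hp : 2 < p) (hpq : p < q)
    (fp fq : ℝ → ℝ) (zp zq : ℝ)
    (hfp : IsBddLegendreSol p fp) (hzp : IsLargestZero fp zp)
    (hfq : IsBddLegendreSol q fq) (hzq : IsLargestZero fq zq) :
    zp < zq := by
  by_contra! hle
  obtain ⟨cp, ep, tp⟩ := hfp
  obtain ⟨cq, eq, tq⟩ := hfq
  obtain ⟨⟨zp0, zp1⟩, zpz, ppos⟩ := hzp
  obtain ⟨⟨zq0, zq1⟩, zqz, qpos⟩ := hzq
  have qpos' : ∀ x ∈ Set.Ioo zp (1:ℝ), 0 < fq x := fun x hx => qpos x ⟨hle.trans_lt hx.1, hx.2⟩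
  let W : ℝ → ℝ := fun x => (1 - x ^ 2) * (deriv fp x * fq x - fp x * deriv fq x)
  have hW : ∀ x ∈ Set.Ioo (-1:ℝ) 1, HasDerivAt W ((q - p) * (fp x * fq x)) x := by
    intro x hx
    obtain ⟨a1, a2⟩ := legendre_derivs cp hx
    obtain ⟨b1, b2⟩ := legendre_derivs cq hx
    have := (((hasDerivAt_id x).pow 2).const_sub 1).mul ((a2.mul b1).sub (a1.mul b2))
    refine this.congr_deriv ?_
    have e1 := ep x hx
    have e2 := eq x hx
    simp
    linear_combination fq x * e1 - fp x * e2
  have hsub : ∀ x ∈ Set.Ico zp (1:ℝ), x ∈ Set.Ioo (-1:ℝ) 1 := fun x hx =>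
    ⟨zp0.trans_le hx.1, hx.2⟩
  have mono : StrictMonoOn W (Set.Ico zp 1) := by
    refine strictMonoOn_of_deriv_pos (convex_Ico _ _)
      (fun x hx => (hW x (hsub x hx)).continuousAt.continuousWithinAt) ?_
    intro x hx
    rw [interior_Ico] at hx
    rw [(hW x (hsub x ⟨hx.1.le, hx.2⟩)).deriv]
    exact mul_pos (sub_pos.2 hpq) (mul_pos (ppos x hx) (qpos' x hx))
  have hW0 : 0 ≤ W zp := by
    have d0 := legendre_deriv_nonneg zp1 (legendre_derivs cp ⟨zp0, zp1⟩).1 zpz ppos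
    have q0 : 0 ≤ fq zp := by
      rcases hle.eq_or_lt with h | h
      · rw [← h, zqz]
      · exact (qpos zp ⟨h, zp1⟩).le
    have : 0 ≤ 1 - zp ^ 2 := by nlinarith
    simp only [W, zpz, zero_mul, sub_zero]
    positivity
  obtain ⟨x0, hx0, hx01⟩ := exists_between zp1
  have hc : 0 < W x0 := hW0.trans_lt (mono ⟨le_rfl, zp1⟩ ⟨hx0.le, hx01⟩ hx0)
  set c := W x0 with hcdef
  have ev : ∀ᶠ x in nhdsWithin (1:ℝ) (Set.Iio 1), fq x < 2 :=
    tq.eventually_lt_const (by norm_num)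
  obtain ⟨l, hl, hl2⟩ := (mem_nhdsLT_iff_exists_Ioo_subset' hx01).1 ev
  obtain ⟨x1, hx1, hx11⟩ := exists_between (max_lt hx01 hl)
  obtain ⟨hx10, hx1l⟩ := max_lt_iff.1 hx1
  let g : ℝ → ℝ := fun x => fp x / fq x + c / 8 * Real.log (1 - x)
  have hg : ∀ x ∈ Set.Ico x1 (1:ℝ), HasDerivAt g
      ((deriv fp x * fq x - fp x * deriv fq x) / fq x ^ 2 + c / 8 * (-1 / (1 - x))) x := by
    intro x hx
    have hx' : x ∈ Set.Ioo zp (1:ℝ) := ⟨by linarith [hx.1], hx.2⟩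
    have hq := qpos' x hx'
    have hxx := hsub x ⟨hx'.1.le, hx.2⟩
    exact ((legendre_derivs cp hxx).1.div (legendre_derivs cq hxx).1 hq.ne').add
      ((((hasDerivAt_id x).const_sub 1).log (sub_pos.2 hx.2).ne').const_mul (c / 8))
  have gmono : MonotoneOn g (Set.Ico x1 1) := by
    refine monotoneOn_of_deriv_nonneg (convex_Ico _ _)
      (fun x hx => (hg x hx).continuousAt.continuousWithinAt)
      (fun x hx => ((hg x (interior_subset hx)).differentiableAt).differentiableWithinAt) ?_
    intro x hx
    have hx := interior_subset hx
    rw [(hg x hx).deriv]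
    have hx' : x ∈ Set.Ioo zp (1:ℝ) := ⟨by linarith [hx.1], hx.2⟩
    have hq := qpos' x hx'
    have hq2 : fq x < 2 := hl2 ⟨by linarith [hx.1], hx.2⟩
    have hxx := hsub x ⟨hx'.1.le, hx.2⟩
    have hWx : c ≤ W x := mono.monotoneOn ⟨hx0.le, hx01⟩ ⟨hx'.1.le, hx.2⟩ (by linarith [hx.1])
    simp only [W] at hWx
    set D := deriv fp x * fq x - fp x * deriv fq x
    have h1 : 0 < 1 - x := by linarith [hx.2]
    have h2 : 0 < 1 + x := by linarith [hxx.1]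
    have hD : 0 < D := by
      have : 0 < (1 - x ^ 2) * D := hc.trans_le hWx
      exact pos_of_mul_pos_right this (by nlinarith)
    have hD2 : c ≤ 2 * (1 - x) * D := by nlinarith [mul_pos (mul_pos h1 h1) hD]
    have h4 : fq x ^ 2 ≤ 4 := by nlinarith
    have : c / 8 * (1 / (1 - x)) ≤ D / fq x ^ 2 := by
      calc c / 8 * (1 / (1 - x)) ≤ D / 4 := by
            rw [mul_one_div, div_le_iff₀ h1]; linarith
        _ ≤ D / fq x ^ 2 := by gcongr
    have e : c / 8 * (-1 / (1 - x)) = -(c / 8 * (1 / (1 - x))) := by ring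
    rw [e]; linarith
  have hbot : Filter.Tendsto g (nhdsWithin 1 (Set.Iio 1)) Filter.atBot := by
    have t1 : Filter.Tendsto (fun x => fp x / fq x) (nhdsWithin 1 (Set.Iio 1)) (nhds (1 / 1)) :=
      tp.div tq one_ne_zero
    have t2 : Filter.Tendsto (fun x : ℝ => 1 - x) (nhdsWithin 1 (Set.Iio 1))
        (nhdsWithin 0 (Set.Ioi 0)) := by
      refine tendsto_nhdsWithin_iff.2 ⟨?_, ?_⟩
      · have : Filter.Tendsto (fun x : ℝ => 1 - x) (nhds 1) (nhds (1 - 1)) :=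
          (continuous_const.sub continuous_id).tendsto 1
        rw [sub_self] at this
        exact this.mono_left nhdsWithin_le_nhds
      · filter_upwards [self_mem_nhdsWithin] with x hx
        exact sub_pos.2 (Set.mem_Iio.1 hx)
    exact t1.add_atBot ((Real.tendsto_log_nhdsGT_zero.comp t2).const_mul_atBot (by positivity))
  obtain ⟨x, hxlt, hxI⟩ := ((hbot.eventually (Filter.eventually_lt_atBot (g x1))).and
    (Ioo_mem_nhdsLT hx11)).exists
  exact absurd (gmono ⟨le_rfl, hx11⟩ ⟨hxI.1.le, hxI.2⟩ hxI.1.le) (not_le.2 hxlt)
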